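/- Let G be a finite connected graph on n ≥ 2 nodes with positive edge weights, L = Cᵀ B C its weighted Laplacian, and L⁺ the Moore–Penrose pseudoinverse of L. Then each diagonal entry of L⁺ is the largest element of its row: L⁺_{ii} ≥ L⁺_{ij} for all nodes i, j. -/

import Mathlib

open Matrix

section Incidence

variable {V E : Type*} [Fintype V]

lemma incidence_row_dotProduct {c : V → ℝ} {i j : V} (hij : i ≠ j) (hi : c i = 1)
    (hj : c j = -1) (h0 : ∀ k, k ≠ i → k ≠ j → c k = 0) (x : V → ℝ) :
    c ⬝ᵥ x = x i - x j := by
  rw [dotProduct, Fintype.sum_eq_add i j hij fun k hk => by rw [h0 k hk.1 hk.2, zero_mul], hi, hj]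
  ring

lemma incidence_mulVec_eq_zero_of_laplacian [Fintype E] [DecidableEq E]
    {C : Matrix E V ℝ} {β : E → ℝ} (hβ : ∀ ℓ, 0 < β ℓ) {x : V → ℝ}
    (hx : (Cᵀ * diagonal β * C) *ᵥ x = 0) : C *ᵥ x = 0 := by
  have energy : ∑ ℓ, β ℓ * (C *ᵥ x) ℓ ^ 2 = 0 := by
    have h : x ⬝ᵥ ((Cᵀ * diagonal β * C) *ᵥ x) = 0 := by rw [hx, dotProduct_zero]
    rw [← mulVec_mulVec, ← mulVec_mulVec, dotProduct_mulVec, vecMul_transpose] at h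
    rw [← h]
    refine Finset.sum_congr rfl fun ℓ _ => ?_
    rw [mulVec_diagonal]
    ring
  rw [Finset.sum_eq_zero_iff_of_nonneg
    fun ℓ _ => mul_nonneg (hβ ℓ).le (sq_nonneg _)] at energy
  ext ℓ
  simpa [(hβ ℓ).ne'] using energy ℓ (Finset.mem_univ ℓ)

/-- Every row of `C` has one entry `1` and one entry `-1`, and its other entries are `0`. -/
def IsOrientedIncidence (C : Matrix E V ℝ) : Prop :=
  ∀ ℓ, ∃ i j, i ≠ j ∧ C ℓ i = 1 ∧ C ℓ j = -1 ∧ ∀ k, k ≠ i → k ≠ j → C ℓ k = 0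

variable {C : Matrix E V ℝ}

lemma incidence_mul_nonneg_of_max (hC : IsOrientedIncidence C) {x : V → ℝ} {k : V}
    (hk : ∀ j, x j ≤ x k) (ℓ : E) :
    0 ≤ C ℓ k * (C *ᵥ x) ℓ := by
  obtain ⟨i, j, hij, hi, hj, h0⟩ := hC ℓ
  rw [mulVec, incidence_row_dotProduct hij hi hj h0]
  by_cases hki : k = i
  · subst hki; rw [hi]; linarith [hk j]
  by_cases hkj : k = j
  · subst hkj; rw [hj]; linarith [hk i]
  rw [h0 k hki hkj, zero_mul]

lemma laplacian_mulVec_nonneg_of_max [Fintype E] [DecidableEq E]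
    (hC : IsOrientedIncidence C) {β : E → ℝ} (hβ : ∀ ℓ, 0 < β ℓ) {x : V → ℝ} {k : V}
    (hk : ∀ j, x j ≤ x k) : 0 ≤ ((Cᵀ * diagonal β * C) *ᵥ x) k := by
  rw [← mulVec_mulVec, ← mulVec_mulVec]
  refine Finset.sum_nonneg fun ℓ _ => ?_
  rw [mulVec_diagonal]
  change 0 ≤ C ℓ k * (β ℓ * (C *ᵥ x) ℓ)
  rw [mul_left_comm]
  exact mul_nonneg (hβ ℓ).le (incidence_mul_nonneg_of_max hC hk ℓ)

lemma incidence_mulVec_one (hC : IsOrientedIncidence C) : C *ᵥ (1 : V → ℝ) = 0 := by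
  ext ℓ
  obtain ⟨i, j, hij, hi, hj, h0⟩ := hC ℓ
  rw [mulVec, incidence_row_dotProduct hij hi hj h0]
  simp

lemma eq_of_incidence_mulVec_eq_zero (hC : IsOrientedIncidence C)
    (hconn : (SimpleGraph.fromRel fun i j : V => ∃ ℓ : E, C ℓ i ≠ 0 ∧ C ℓ j ≠ 0).Connected)
    {x : V → ℝ} (hx : C *ᵥ x = 0) (a b : V) : x a = x b := by
  have edge : ∀ u v, (∃ ℓ : E, C ℓ u ≠ 0 ∧ C ℓ v ≠ 0) → x u = x v := by
    rintro u v ⟨ℓ, hu, hv⟩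
    obtain ⟨i, j, hij, hi, hj, h0⟩ := hC ℓ
    have hxij : x i - x j = 0 := by
      rw [← incidence_row_dotProduct hij hi hj h0]
      exact congrFun hx ℓ
    have end_eq : ∀ w, C ℓ w ≠ 0 → x w = x i := by
      intro w hw
      by_cases hwi : w = i
      · rw [hwi]
      by_cases hwj : w = j
      · rw [hwj]; linarith
      exact absurd (h0 w hwi hwj) hw
    rw [end_eq u hu, end_eq v hv]
  obtain ⟨p⟩ := hconn.preconnected a b
  induction p with
  | nil => rfl
  | cons h _ ih =>
    rw [SimpleGraph.fromRel_adj] at h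
    refine Eq.trans ?_ ih
    exact h.2.elim (edge _ _) fun h' => (edge _ _ h').symm

end Incidence

/-- Each diagonal entry of the Moore–Penrose pseudoinverse `L⁺` of the weighted
Laplacian of a finite connected graph is the largest element of its row:
`L⁺ i i ≥ L⁺ i j` for all nodes `i, j`. -/
theorem stmt_6
    (n m : ℕ) (hn : 2 ≤ n)
    (C : Matrix (Fin m) (Fin n) ℝ)
    (hC : ∀ ℓ : Fin m, ∃ i j : Fin n, i ≠ j ∧ C ℓ i = 1 ∧ C ℓ j = -1 ∧
      ∀ k : Fin n, k ≠ i → k ≠ j → C ℓ k = 0)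
    (hconn : (SimpleGraph.fromRel
      (fun i j : Fin n => ∃ ℓ : Fin m, C ℓ i ≠ 0 ∧ C ℓ j ≠ 0)).Connected)
    (β : Fin m → ℝ) (hβ : ∀ ℓ, 0 < β ℓ)
    (L : Matrix (Fin n) (Fin n) ℝ)
    (hL : L = Cᵀ * Matrix.diagonal β * C)
    (Lplus : Matrix (Fin n) (Fin n) ℝ)
    (hMP : L * Lplus * L = L ∧ Lplus * L * Lplus = Lplus ∧
      (L * Lplus)ᵀ = L * Lplus ∧ (Lplus * L)ᵀ = Lplus * L) :
    ∀ i j : Fin n, Lplus i j ≤ Lplus i i := by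
  obtain ⟨h1, -, -, h4⟩ := hMP
  have hLs : Lᵀ = L := by
    rw [hL]; simp [Matrix.mul_assoc]
  set R : Matrix (Fin n) (Fin n) ℝ := 1 - Lplus * L with hR
  have hRs : Rᵀ = R := by rw [hR, transpose_sub, h4, transpose_one]
  have hcol : ∀ k a b, R a k = R b k := by
    intro k
    have hker : L *ᵥ R.col k = 0 := by
      have : L * R = 0 := by rw [hR, mul_sub, mul_one, ← mul_assoc, h1, sub_self]
      ext a
      exact congrFun (congrFun this a) k
    rw [hL] at hker
    exact eq_of_incidence_mulVec_eq_zero hC hconn (incidence_mulVec_eq_zero_of_laplacian hβ hker)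
  have hrow : ∀ a k l, R a k = R a l := fun a k l => by
    rw [← hRs]; exact hcol a k l
  have hpos : ∀ a k, 0 < R a k := by
    intro a k
    have hone : R *ᵥ 1 = 1 := by
      rw [hR, sub_mulVec, one_mulVec, hL, ← mulVec_mulVec, ← mulVec_mulVec,
        incidence_mulVec_one hC, mulVec_zero, mulVec_zero, sub_zero]
    have hsum : ∑ l, R a l = 1 := by
      simpa [mulVec, dotProduct] using congrFun hone a
    rw [Finset.sum_congr rfl fun l _ => hrow a l k] at hsum
    rw [Finset.sum_const, Finset.card_univ, Fintype.card_fin, nsmul_eq_mul] at hsum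
    exact pos_of_mul_pos_right (hsum ▸ one_pos) (Nat.cast_nonneg n)
  intro i j
  have : Nonempty (Fin n) := ⟨i⟩
  obtain ⟨k, hk⟩ := Finite.exists_max (Lplus i)
  obtain rfl | hki := eq_or_ne i k
  · exact hk j
  have hnonneg := laplacian_mulVec_nonneg_of_max hC hβ hk
  rw [← hL, ← hLs, mulVec_transpose] at hnonneg
  have hneg : (Lplus i ᵥ* L) k = - R i k := by
    rw [hR, Matrix.sub_apply, one_apply_ne hki, zero_sub, neg_neg]
    rfl
  linarith [hpos i k]
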